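/- Let m ≥ 2 be an integer and let f : ℝ^m → ℝ be a smooth function satisfying: (i) ∂²f/∂x₁² = f; (ii) ∂²f/∂x_i∂x_j = tanh(x_i) ∂f/∂x_j for all 1 ≤ i < j ≤ m; (iii) ∂²f/∂x_k² = −Σ_{j=1}^{k−1} (sinh(2x_j)/2)(∏_{i=j+1}^{k−1} cosh²x_i) ∂f/∂x_j + f ∏_{j=1}^{k−1} cosh²x_j for all 2 ≤ k ≤ m. Then there exist real numbers b₁, …, b_{m+1} such that f(x₁,…,x_m) = b₁ sinh x₁ + b₂ sinh x₂ cosh x₁ + ⋯ + b_m sinh x_m ∏_{j=1}^{m−1} cosh x_j + b_{m+1} ∏_{j=1}^{m} cosh x_j, i.e., f(x) = Σ_{k=1}^{m} b_k sinh(x_k) ∏_{j=1}^{k−1} cosh x_j + b_{m+1} ∏_{j=1}^{m} cosh x_j. -/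

import Mathlib

open Real

/-- Partial derivative at `x` in the direction of the `i`-th standard basis vector,
in the sense of the Fréchet derivative. -/
noncomputable def pd {n : ℕ} {F : Type*} [NormedAddCommGroup F] [NormedSpace ℝ F]
    (L : EuclideanSpace ℝ (Fin n) → F) (x : EuclideanSpace ℝ (Fin n)) (i : Fin n) : F :=
  fderiv ℝ L x (EuclideanSpace.single i 1)

/-- Second partial derivative at `x` in the directions of the `i`-th and `j`-th
standard basis vectors. -/
noncomputable def pd2 {n : ℕ} {F : Type*} [NormedAddCommGroup F] [NormedSpace ℝ F]
    (L : EuclideanSpace ℝ (Fin n) → F) (x : EuclideanSpace ℝ (Fin n)) (i j : Fin n) : F :=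
  pd (fun y => pd L y i) x j

section PartialDerivatives

variable {m : ℕ} {g h : EuclideanSpace ℝ (Fin m) → ℝ} {x : EuclideanSpace ℝ (Fin m)}

theorem pd_mul (hg : DifferentiableAt ℝ g x) (hh : DifferentiableAt ℝ h x) (j : Fin m) :
    pd (fun y => g y * h y) x j = pd g x j * h x + g x * pd h x j := by
  simp only [pd, fderiv_fun_mul hg hh, add_apply,
    smul_apply, smul_eq_mul]
  ring

theorem pd_sub (hg : DifferentiableAt ℝ g x) (hh : DifferentiableAt ℝ h x) (j : Fin m) :
    pd (fun y => g y - h y) x j = pd g x j - pd h x j := by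
  simp only [pd, fderiv_fun_sub hg hh, sub_apply]

theorem contDiff_pd (hg : ContDiff ℝ (⊤ : ℕ∞) g) (j : Fin m) :
    ContDiff ℝ (⊤ : ℕ∞) (fun y => pd g y j) :=
  (hg.fderiv_right (m := (⊤ : ℕ∞)) (by simp)).clm_apply contDiff_const

theorem pd2_comm (hg : ContDiff ℝ (⊤ : ℕ∞) g) (x : EuclideanSpace ℝ (Fin m)) (i j : Fin m) :
    pd2 g x i j = pd2 g x j i := by
  have hd : DifferentiableAt ℝ (fderiv ℝ g) x :=
    (hg.fderiv_right (m := (⊤ : ℕ∞)) (by simp)).differentiable (by simp) x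
  have hs : IsSymmSndFDerivAt ℝ g x :=
    hg.contDiffAt.isSymmSndFDerivAt <| by
      simpa using WithTop.coe_le_coe.2 (le_top (a := (2 : ℕ∞)))
  have key (a b : Fin m) : pd2 g x a b =
      fderiv ℝ (fderiv ℝ g) x (EuclideanSpace.single b 1) (EuclideanSpace.single a 1) := by
    simp only [pd2, pd]
    rw [fderiv_clm_apply hd (differentiableAt_const _)]
    simp
  rw [key, key, hs.eq]

theorem eq_of_pd_eq_zero (hg : Differentiable ℝ g) (h0 : ∀ x j, pd g x j = 0)
    (x y : EuclideanSpace ℝ (Fin m)) : g x = g y := by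
  refine is_const_of_fderiv_eq_zero hg (fun z => ?_) x y
  apply ContinuousLinearMap.coe_injective
  refine (EuclideanSpace.basisFun (Fin m) ℝ).toBasis.ext fun j => ?_
  simpa [pd] using h0 z j

theorem pd_cosh_apply (x : EuclideanSpace ℝ (Fin m)) (i j : Fin m) :
    pd (fun y => cosh (y i)) x j = if i = j then sinh (x i) else 0 := by
  have hp : HasFDerivAt (fun y : EuclideanSpace ℝ (Fin m) => y i)
      (EuclideanSpace.proj i : EuclideanSpace ℝ (Fin m) →L[ℝ] ℝ) x :=
    (EuclideanSpace.proj i : EuclideanSpace ℝ (Fin m) →L[ℝ] ℝ).hasFDerivAt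
  simp [pd, hp.cosh.fderiv]

theorem pd_sinh_apply (x : EuclideanSpace ℝ (Fin m)) (i j : Fin m) :
    pd (fun y => sinh (y i)) x j = if i = j then cosh (x i) else 0 := by
  have hp : HasFDerivAt (fun y : EuclideanSpace ℝ (Fin m) => y i)
      (EuclideanSpace.proj i : EuclideanSpace ℝ (Fin m) →L[ℝ] ℝ) x :=
    (EuclideanSpace.proj i : EuclideanSpace ℝ (Fin m) →L[ℝ] ℝ).hasFDerivAt
  simp [pd, hp.sinh.fderiv]

end PartialDerivatives

section Reduction

variable {m : ℕ}

/-- The `k`-th coordinate of `x`, extended by zero to all natural numbers `k`. -/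
noncomputable def coord (k : ℕ) (x : EuclideanSpace ℝ (Fin m)) : ℝ :=
  if h : k < m then x ⟨k, h⟩ else 0

/-- The product of the hyperbolic cosines of the first `k` coordinates. -/
noncomputable def coshProd (k : ℕ) (x : EuclideanSpace ℝ (Fin m)) : ℝ :=
  ∏ i ∈ Finset.range k, cosh (coord i x)

/-- The `k`-th partial derivative divided by `coshProd k`, extended by zero to all `k`. -/
noncomputable def scaledPartial (f : EuclideanSpace ℝ (Fin m) → ℝ) (k : ℕ)
    (x : EuclideanSpace ℝ (Fin m)) : ℝ :=
  if h : k < m then pd f x ⟨k, h⟩ / coshProd k x else 0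

/-- The coefficient of `coshProd k` once the first `k` hyperbolic sine terms are split off. -/
noncomputable def coshCoeff (f : EuclideanSpace ℝ (Fin m) → ℝ) :
    ℕ → EuclideanSpace ℝ (Fin m) → ℝ
  | 0, x => f x
  | k + 1, x => coshCoeff f k x * cosh (coord k x) - scaledPartial f k x * sinh (coord k x)

/-- The coefficient of `sinh (coord k) * coshProd k`. -/
noncomputable def sinhCoeff (f : EuclideanSpace ℝ (Fin m) → ℝ) (k : ℕ)
    (x : EuclideanSpace ℝ (Fin m)) : ℝ :=
  scaledPartial f k x * cosh (coord k x) - coshCoeff f k x * sinh (coord k x)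

theorem coord_val (k : Fin m) (x : EuclideanSpace ℝ (Fin m)) : coord k x = x k := by
  simp [coord]

theorem coord_of_lt {k : ℕ} (h : k < m) (x : EuclideanSpace ℝ (Fin m)) :
    coord k x = x ⟨k, h⟩ := dif_pos h

theorem coshProd_pos (k : ℕ) (x : EuclideanSpace ℝ (Fin m)) : 0 < coshProd k x :=
  Finset.prod_pos fun _ _ => cosh_pos _

theorem coshProd_succ (k : ℕ) (x : EuclideanSpace ℝ (Fin m)) :
    coshProd (k + 1) x = coshProd k x * cosh (coord k x) :=
  Finset.prod_range_succ _ _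

theorem contDiff_coord (k : ℕ) :
    ContDiff ℝ (⊤ : ℕ∞) (coord k : EuclideanSpace ℝ (Fin m) → ℝ) := by
  unfold coord
  split_ifs <;> fun_prop

theorem contDiff_coshProd (k : ℕ) :
    ContDiff ℝ (⊤ : ℕ∞) (coshProd k : EuclideanSpace ℝ (Fin m) → ℝ) :=
  contDiff_prod fun i _ => (contDiff_coord i).cosh

theorem pd_cosh_coord {k : ℕ} (hk : k < m) (x : EuclideanSpace ℝ (Fin m)) (j : Fin m) :
    pd (fun y => cosh (coord k y)) x j = if (j : ℕ) = k then sinh (coord k x) else 0 := by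
  simp only [coord_of_lt hk, pd_cosh_apply, Fin.ext_iff, eq_comm]

theorem pd_sinh_coord {k : ℕ} (hk : k < m) (x : EuclideanSpace ℝ (Fin m)) (j : Fin m) :
    pd (fun y => sinh (coord k y)) x j = if (j : ℕ) = k then cosh (coord k x) else 0 := by
  simp only [coord_of_lt hk, pd_sinh_apply, Fin.ext_iff, eq_comm]

theorem pd_coshProd {k : ℕ} (hk : k ≤ m) (x : EuclideanSpace ℝ (Fin m)) (j : Fin m) :
    pd (coshProd k) x j = if (j : ℕ) < k then tanh (x j) * coshProd k x else 0 := by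
  induction k with
  | zero =>
    have heq : (coshProd 0 : EuclideanSpace ℝ (Fin m) → ℝ) = fun _ => 1 :=
      funext fun _ => Finset.prod_range_zero _
    simp [pd, heq]
  | succ k ih =>
    have hd := (contDiff_coshProd (m := m) k).differentiable (by simp) x
    have hc := (contDiff_coord (m := m) k).cosh.differentiable (by simp) x
    have heq : (coshProd (k + 1) : EuclideanSpace ℝ (Fin m) → ℝ) =
        fun y => coshProd k y * cosh (coord k y) := funext (coshProd_succ k)
    rw [coshProd_succ, heq, pd_mul hd hc, ih (by omega), pd_cosh_coord (by omega)]
    rcases lt_trichotomy (j : ℕ) k with h | h | h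
    · simp only [h, h.ne, Nat.lt_succ_of_lt h, if_true, if_false]
      ring
    · have := (cosh_pos (x j)).ne'
      subst h
      simp only [lt_irrefl, Nat.lt_succ_self, if_true, if_false, coord_val, tanh_eq_sinh_div_cosh]
      field_simp
      ring
    · rw [if_neg (by omega), if_neg (by omega), if_neg (by omega)]
      ring

variable {f : EuclideanSpace ℝ (Fin m) → ℝ}

theorem contDiff_scaledPartial (hf : ContDiff ℝ (⊤ : ℕ∞) f) (k : ℕ) :
    ContDiff ℝ (⊤ : ℕ∞) (scaledPartial f k) := by
  unfold scaledPartial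
  split_ifs with h
  · exact (contDiff_pd hf _).div (contDiff_coshProd k) fun x => (coshProd_pos k x).ne'
  · exact contDiff_const

theorem contDiff_coshCoeff (hf : ContDiff ℝ (⊤ : ℕ∞) f) (k : ℕ) :
    ContDiff ℝ (⊤ : ℕ∞) (coshCoeff f k) := by
  induction k with
  | zero => exact hf
  | succ k ih =>
    exact (ih.mul (contDiff_coord k).cosh).sub
      ((contDiff_scaledPartial hf k).mul (contDiff_coord k).sinh)

theorem pd_eq_scaledPartial_mul (k : Fin m) (x : EuclideanSpace ℝ (Fin m)) :
    pd f x k = scaledPartial f k x * coshProd k x := by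
  have := (coshProd_pos k x).ne'
  simp [scaledPartial, this]

theorem pd2_eq_pd_scaledPartial (hf : ContDiff ℝ (⊤ : ℕ∞) f) (k j : Fin m)
    (x : EuclideanSpace ℝ (Fin m)) :
    pd2 f x k j = pd (scaledPartial f k) x j * coshProd k x +
      scaledPartial f k x * if j < k then tanh (x j) * coshProd k x else 0 := by
  have hs := (contDiff_scaledPartial hf k).differentiable (by simp) x
  have hd := (contDiff_coshProd (m := m) k).differentiable (by simp) x
  simp only [pd2, pd_eq_scaledPartial_mul k]
  rw [pd_mul hs hd, pd_coshProd k.isLt.le]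
  rfl

theorem pd_scaledPartial_of_lt (hf : ContDiff ℝ (⊤ : ℕ∞) f)
    (h2 : ∀ x, ∀ i j : Fin m, i < j → pd2 f x i j = tanh (x i) * pd f x j)
    {k j : Fin m} (hjk : j < k) (x : EuclideanSpace ℝ (Fin m)) :
    pd (scaledPartial f k) x j = 0 := by
  have e := pd2_eq_pd_scaledPartial hf k j x
  rw [pd2_comm hf, h2 x j k hjk, if_pos hjk, pd_eq_scaledPartial_mul k] at e
  have : pd (scaledPartial f k) x j * coshProd k x = 0 := by linarith
  exact (mul_eq_zero.mp this).resolve_right (coshProd_pos k x).ne'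

theorem pd_scaledPartial_of_gt (hf : ContDiff ℝ (⊤ : ℕ∞) f)
    (h2 : ∀ x, ∀ i j : Fin m, i < j → pd2 f x i j = tanh (x i) * pd f x j)
    {k j : Fin m} (hkj : k < j) (x : EuclideanSpace ℝ (Fin m)) :
    pd (scaledPartial f k) x j = tanh (x k) * (pd f x j / coshProd k x) := by
  have e := pd2_eq_pd_scaledPartial hf k j x
  rw [h2 x k j hkj, if_neg hkj.not_gt, mul_zero, add_zero] at e
  rw [← mul_div_assoc, e, mul_div_cancel_right₀ _ (coshProd_pos k x).ne']

theorem pd_scaledPartial_self (hf : ContDiff ℝ (⊤ : ℕ∞) f)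
    (h3 : ∀ x, ∀ k : Fin m, pd2 f x k k = coshProd k x * coshCoeff f k x)
    (k : Fin m) (x : EuclideanSpace ℝ (Fin m)) :
    pd (scaledPartial f k) x k = coshCoeff f k x := by
  have e := pd2_eq_pd_scaledPartial hf k k x
  rw [h3, if_neg (lt_irrefl _), mul_zero, add_zero, mul_comm] at e
  exact (mul_right_cancel₀ (coshProd_pos k x).ne' e).symm

theorem pd_coshCoeff (hf : ContDiff ℝ (⊤ : ℕ∞) f)
    (h2 : ∀ x, ∀ i j : Fin m, i < j → pd2 f x i j = tanh (x i) * pd f x j)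
    (h3 : ∀ x, ∀ k : Fin m, pd2 f x k k = coshProd k x * coshCoeff f k x)
    {k : ℕ} (hk : k ≤ m) (j : Fin m) (x : EuclideanSpace ℝ (Fin m)) :
    pd (coshCoeff f k) x j = if (j : ℕ) < k then 0 else pd f x j / coshProd k x := by
  induction k with
  | zero => simp [coshProd, show coshCoeff f 0 = f from rfl]
  | succ k ih =>
    have hF := (contDiff_coshCoeff hf k).differentiable (by simp) x
    have hU := (contDiff_scaledPartial hf k).differentiable (by simp) x
    have hc := (contDiff_coord (m := m) k).cosh.differentiable (by simp) x
    have hs := (contDiff_coord (m := m) k).sinh.differentiable (by simp) x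
    have hkm : k < m := hk
    have heq : coshCoeff f (k + 1) = fun y =>
      coshCoeff f k y * cosh (coord k y) - scaledPartial f k y * sinh (coord k y) := rfl
    rw [heq, pd_sub (hF.fun_mul hc) (hU.fun_mul hs), pd_mul hF hc, pd_mul hU hs, ih hkm.le,
      pd_cosh_coord hkm, pd_sinh_coord hkm]
    rcases lt_trichotomy (j : ℕ) k with h | h | h
    · rw [pd_scaledPartial_of_lt (k := ⟨k, hkm⟩) hf h2 h, if_pos h, if_neg h.ne, if_neg h.ne,
        if_pos (by omega)]
      ring
    · subst h
      rw [pd_scaledPartial_self hf h3, pd_eq_scaledPartial_mul j]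
      have := (coshProd_pos j x).ne'
      simp only [lt_irrefl, Nat.lt_succ_self, if_true, if_false]
      field_simp
      ring
    · rw [pd_scaledPartial_of_gt (k := ⟨k, hkm⟩) hf h2 h, if_neg (by omega), if_neg (by omega),
        if_neg (by omega), if_neg (by omega), coshProd_succ, coord_of_lt hkm,
        tanh_eq_sinh_div_cosh]
      have h₁ := (coshProd_pos k x).ne'
      have h₂ := (cosh_pos (x ⟨k, hkm⟩)).ne'
      field_simp
      linear_combination pd f x j * cosh_sq_sub_sinh_sq (x ⟨k, hkm⟩)

theorem pd_sinhCoeff (hf : ContDiff ℝ (⊤ : ℕ∞) f)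
    (h2 : ∀ x, ∀ i j : Fin m, i < j → pd2 f x i j = tanh (x i) * pd f x j)
    (h3 : ∀ x, ∀ k : Fin m, pd2 f x k k = coshProd k x * coshCoeff f k x)
    (k j : Fin m) (x : EuclideanSpace ℝ (Fin m)) :
    pd (sinhCoeff f k) x j = 0 := by
  have hF := (contDiff_coshCoeff hf k).differentiable (by simp) x
  have hU := (contDiff_scaledPartial hf k).differentiable (by simp) x
  have hc := (contDiff_coord (m := m) k).cosh.differentiable (by simp) x
  have hs := (contDiff_coord (m := m) k).sinh.differentiable (by simp) x
  have heq : sinhCoeff f k = fun y =>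
    scaledPartial f k y * cosh (coord k y) - coshCoeff f k y * sinh (coord k y) := rfl
  rw [heq, pd_sub (hU.fun_mul hc) (hF.fun_mul hs), pd_mul hF hs, pd_mul hU hc,
    pd_coshCoeff hf h2 h3 k.isLt.le, pd_cosh_coord k.isLt, pd_sinh_coord k.isLt]
  rcases lt_trichotomy j k with h | h | h
  · have h' : (j : ℕ) < k := h
    rw [pd_scaledPartial_of_lt hf h2 h, if_pos h', if_neg h'.ne, if_neg h'.ne]
    ring
  · subst h
    rw [pd_scaledPartial_self hf h3, pd_eq_scaledPartial_mul j]
    have := (coshProd_pos j x).ne'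
    simp only [lt_irrefl, if_true, if_false]
    field_simp
    ring
  · have h' : (k : ℕ) < j := h
    rw [pd_scaledPartial_of_gt hf h2 h, if_neg (by omega), if_neg (by omega),
      if_neg (by omega), coord_val, tanh_eq_sinh_div_cosh]
    have := (cosh_pos (x k)).ne'
    field_simp
    ring

theorem coshProd_mul_coshCoeff {k : ℕ} (hk : k ≤ m) (x : EuclideanSpace ℝ (Fin m)) :
    coshProd k x * coshCoeff f k x =
      -(∑ j : Fin k, (sinh (2 * x (Fin.castLE hk j)) / 2) *
          (∏ i : Fin k, if (j : ℕ) < (i : ℕ) then cosh (x (Fin.castLE hk i)) ^ 2 else 1) *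
          pd f x (Fin.castLE hk j)) +
        f x * ∏ j : Fin k, cosh (x (Fin.castLE hk j)) ^ 2 := by
  induction k with
  | zero => simp [coshProd, coshCoeff]
  | succ k ih =>
    have hkm : k < m := hk
    have hD := pd_eq_scaledPartial_mul (f := f) ⟨k, hkm⟩ x
    have hlast : Fin.castLE hk (Fin.last k) = ⟨k, hkm⟩ := rfl
    have hcast (j : Fin k) : Fin.castLE hk j.castSucc = Fin.castLE hkm.le j := rfl
    have hone : (∏ i : Fin k, if k < (i : ℕ) then
        cosh (x (Fin.castLE hkm.le i)) ^ 2 else 1) = 1 :=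
      Finset.prod_eq_one fun i _ => if_neg (by omega)
    have hsum : (∑ j : Fin k, (sinh (2 * x (Fin.castLE hkm.le j)) / 2) *
          ((∏ i : Fin k, if (j : ℕ) < (i : ℕ) then
            cosh (x (Fin.castLE hkm.le i)) ^ 2 else 1) * cosh (x ⟨k, hkm⟩) ^ 2) *
          pd f x (Fin.castLE hkm.le j)) =
        (∑ j : Fin k, (sinh (2 * x (Fin.castLE hkm.le j)) / 2) *
          (∏ i : Fin k, if (j : ℕ) < (i : ℕ) then
            cosh (x (Fin.castLE hkm.le i)) ^ 2 else 1) *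
          pd f x (Fin.castLE hkm.le j)) * cosh (x ⟨k, hkm⟩) ^ 2 := by
      rw [Finset.sum_mul]
      exact Finset.sum_congr rfl fun _ _ => by ring
    simp only [Fin.sum_univ_castSucc, Fin.prod_univ_castSucc, Fin.val_castSucc, Fin.val_last,
      hlast, hcast, hone, lt_irrefl, if_false, Fin.is_lt, if_true, hsum]
    rw [coshProd_succ, coshCoeff, coord_of_lt hkm, hD, sinh_two_mul]
    linear_combination cosh (x ⟨k, hkm⟩) ^ 2 * ih hkm.le

theorem eq_sum_sinhCoeff_add_coshCoeff (k : ℕ) (x : EuclideanSpace ℝ (Fin m)) :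
    f x = (∑ i ∈ Finset.range k, sinhCoeff f i x * sinh (coord i x) * coshProd i x) +
      coshCoeff f k x * coshProd k x := by
  induction k with
  | zero => simp [coshProd, coshCoeff]
  | succ k ih =>
    rw [Finset.sum_range_succ, coshProd_succ, coshCoeff, sinhCoeff]
    linear_combination ih -
      coshCoeff f k x * coshProd k x * cosh_sq_sub_sinh_sq (coord k x)

end Reduction

theorem stmt13 (m : ℕ) (hm : 2 ≤ m)
    (f : EuclideanSpace ℝ (Fin m) → ℝ)
    (hf : ContDiff ℝ (⊤ : ℕ∞) f)
    (h1 : ∀ x, pd2 f x ⟨0, by omega⟩ ⟨0, by omega⟩ = f x)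
    (h2 : ∀ x, ∀ i j : Fin m, i < j →
      pd2 f x i j = Real.tanh (x i) * pd f x j)
    (h3 : ∀ x, ∀ k : Fin m, 1 ≤ (k : ℕ) →
      pd2 f x k k =
        -(∑ j : Fin (k : ℕ),
          (Real.sinh (2 * x (Fin.castLE k.isLt.le j)) / 2) *
            (∏ i : Fin (k : ℕ), if (j : ℕ) < (i : ℕ) then
              Real.cosh (x (Fin.castLE k.isLt.le i)) ^ 2 else 1) *
            pd f x (Fin.castLE k.isLt.le j)) +
        f x * ∏ j : Fin (k : ℕ), Real.cosh (x (Fin.castLE k.isLt.le j)) ^ 2) :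
    ∃ b : Fin (m + 1) → ℝ, ∀ x,
      f x = (∑ k : Fin m,
          b (Fin.castSucc k) * Real.sinh (x k) *
            ∏ j : Fin (k : ℕ), Real.cosh (x (Fin.castLE k.isLt.le j))) +
        b (Fin.last m) * ∏ j : Fin m, Real.cosh (x j) := by
  have h3' : ∀ x, ∀ k : Fin m, pd2 f x k k = coshProd k x * coshCoeff f k x := by
    intro x k
    rcases Nat.eq_zero_or_pos (k : ℕ) with hk | hk
    · have hk0 : k = ⟨0, by omega⟩ := Fin.ext hk
      rw [hk0, h1]
      simp [coshProd, coshCoeff]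
    · rw [h3 x k hk, coshProd_mul_coshCoeff k.isLt.le]
  have hsinh (k : Fin m) (x : EuclideanSpace ℝ (Fin m)) :
      sinhCoeff f k x = sinhCoeff f k 0 :=
    eq_of_pd_eq_zero ((((contDiff_scaledPartial hf k).mul (contDiff_coord k).cosh).sub
      ((contDiff_coshCoeff hf k).mul (contDiff_coord k).sinh)).differentiable (by simp))
      (fun y j => pd_sinhCoeff hf h2 h3' k j y) x 0
  have hcosh (x : EuclideanSpace ℝ (Fin m)) : coshCoeff f m x = coshCoeff f m 0 :=
    eq_of_pd_eq_zero ((contDiff_coshCoeff hf m).differentiable (by simp))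
      (fun y j => by rw [pd_coshCoeff hf h2 h3' le_rfl, if_pos j.isLt]) x 0
  have hprod {k : ℕ} (hk : k ≤ m) (x : EuclideanSpace ℝ (Fin m)) :
      coshProd k x = ∏ j : Fin k, cosh (x (Fin.castLE hk j)) := by
    rw [coshProd, Finset.prod_range]
    exact Finset.prod_congr rfl fun j _ => by rw [← coord_val]; rfl
  refine ⟨Fin.snoc (fun k : Fin m => sinhCoeff f k 0) (coshCoeff f m 0), fun x => ?_⟩
  rw [eq_sum_sinhCoeff_add_coshCoeff (f := f) m x, Finset.sum_range, hcosh, hprod le_rfl]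
  simp only [Fin.snoc_castSucc, Fin.snoc_last, hsinh, coord_val, Fin.castLE_rfl, id]
  congr 1
  exact Finset.sum_congr rfl fun k _ => by rw [hprod k.isLt.le]
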